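/- Let Y₃, Y₄, Y₅ be independent standard Gaussian random variables. Then E[ | (1/(2√2))·Y₃Y₅ + (1/8)·Y₃² − (1/8)·Y₄² | · H₂(Y₅) ] = 1/(3√3). Consequently the projection coefficient h₂₅ := −(1/π)·E[ | (1/(2√2))·Y₃Y₅ + (1/8)·Y₃² − (1/8)·Y₄² | · H₂(Y₅) ] equals −1/(3√3·π). -/

import Mathlib

open MeasureTheory ProbabilityTheory Real

/-- The law of three independent standard Gaussian random variables:
the product of three standard Gaussian measures on `ℝ`. -/
noncomputable def gauss3 : Measure (Fin 3 → ℝ) :=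
  Measure.pi fun _ => gaussianReal 0 1

/-- The `q`-th probabilists' Hermite polynomial, evaluated at a real number. -/
noncomputable def hermiteEval (q : ℕ) (x : ℝ) : ℝ :=
  Polynomial.aeval x (Polynomial.hermite q)


lemma aux_int (n : ℕ) {b : ℝ} (hb : 0 < b) : Integrable (fun x : ℝ => x ^ n * exp (-b * x ^ 2)) := by
  have := integrable_rpow_mul_exp_neg_mul_sq hb (s := n) (by have : (0:ℝ) ≤ n := n.cast_nonneg
                                                             linarith)
  simpa [rpow_natCast] using this

lemma aux_tend (n : ℕ) {b : ℝ} (hb : 0 < b) :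
    Filter.Tendsto (fun x : ℝ => x ^ n * exp (-b * x ^ 2)) (Filter.cocompact ℝ) (nhds 0) := by
  have := tendsto_rpow_abs_mul_exp_neg_mul_sq_cocompact hb n
  rw [tendsto_zero_iff_norm_tendsto_zero]
  refine this.congr fun x => ?_
  rw [rpow_natCast, norm_mul, norm_pow, Real.norm_eq_abs, Real.norm_eq_abs, abs_of_pos (exp_pos _)]

lemma aux_final : ∫ u : ℝ, ((12 * u ^ 2 + 4) * exp (-u ^ 2) + 2 * u ^ 4 - 4 * u ^ 2 - 2)
    ∂(gaussianReal 0 1) = 8 / √3 := by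
  rw [integral_gaussianReal_eq_integral_smul one_ne_zero]
  have hb1 : (0:ℝ) < 1/2 := by norm_num
  have hb2 : (0:ℝ) < 3/2 := by norm_num
  set F' : ℝ → ℝ := fun u => 2 * (u ^ 4 * exp (-(1/2) * u ^ 2)) - 4 * (u ^ 2 * exp (-(1/2) * u ^ 2))
      - 2 * (u ^ 0 * exp (-(1/2) * u ^ 2)) + (12 * (u ^ 2 * exp (-(3/2) * u ^ 2))
      - 4 * (u ^ 0 * exp (-(3/2) * u ^ 2))) with hF'
  set F : ℝ → ℝ := fun u => -2 * (u ^ 3 * exp (-(1/2) * u ^ 2)) - 2 * (u ^ 1 * exp (-(1/2) * u ^ 2))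
      - 4 * (u ^ 1 * exp (-(3/2) * u ^ 2)) with hF
  have hd : ∀ u, HasDerivAt F (F' u) u := by
    intro u
    have e1 : HasDerivAt (fun u : ℝ => exp (-(1/2) * u ^ 2)) (exp (-(1/2) * u ^ 2) * (-u)) u := by
      have := ((hasDerivAt_pow 2 u).const_mul (-(1/2) : ℝ)).exp
      convert this using 1; push_cast; ring
    have e2 : HasDerivAt (fun u : ℝ => exp (-(3/2) * u ^ 2)) (exp (-(3/2) * u ^ 2) * (-3*u)) u := by
      have := ((hasDerivAt_pow 2 u).const_mul (-(3/2) : ℝ)).exp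
      convert this using 1; push_cast; ring
    have := ((((hasDerivAt_pow 3 u).mul e1).const_mul (-2)).sub
      (((hasDerivAt_pow 1 u).mul e1).const_mul 2)).sub (((hasDerivAt_pow 1 u).mul e2).const_mul 4)
    refine HasDerivAt.congr_deriv (f := F) this ?_
    rw [hF']; push_cast; ring
  have hi : Integrable F' :=
    ((((aux_int 4 hb1).const_mul 2).sub ((aux_int 2 hb1).const_mul 4)).sub
      ((aux_int 0 hb1).const_mul 2)).add (((aux_int 2 hb2).const_mul 12).sub
      ((aux_int 0 hb2).const_mul 4))
  have ht : Filter.Tendsto F (Filter.cocompact ℝ) (nhds 0) := by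
    have := (((aux_tend 3 hb1).const_mul (-2)).sub ((aux_tend 1 hb1).const_mul 2)).sub
      ((aux_tend 1 hb2).const_mul 4)
    simp only [mul_zero, sub_zero] at this
    exact this
  have h0 : ∫ u, F' u = 0 := by
    have := integral_of_hasDerivAt_of_tendsto hd hi (ht.mono_left atBot_le_cocompact)
      (ht.mono_left atTop_le_cocompact)
    simpa using this
  have hs : ∀ u : ℝ, gaussianPDFReal 0 1 u • ((12 * u ^ 2 + 4) * exp (-u ^ 2) + 2 * u ^ 4
      - 4 * u ^ 2 - 2) = (√(2 * π))⁻¹ * (F' u + 8 * exp (-(3/2) * u ^ 2)) := by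
    intro u
    have h3 : exp (-(3/2) * u ^ 2) = exp (-(1/2) * u ^ 2) * exp (-u ^ 2) := by
      rw [← exp_add]; ring_nf
    have h4 : gaussianPDFReal 0 1 u = (√(2 * π))⁻¹ * exp (-(1/2) * u ^ 2) := by
      rw [gaussianPDFReal]; simp; left; ring
    rw [h4, hF', smul_eq_mul]; simp only [h3]; ring
  simp_rw [hs]
  rw [integral_const_mul, integral_add hi, h0, integral_const_mul, integral_gaussian]
  · have : √(π / (3/2)) = √(2*π) / √3 := by
      rw [← sqrt_div (by positivity)]; congr 1; field_simp
    rw [this]; field_simp; ring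
  · have := (aux_int 0 hb2).const_mul 8
    simpa using this

lemma aux_J (a : ℝ) {s : ℝ} :
   IntegrableOn (fun r : ℝ => r * ((r^2 - 2*a) * (r^2+a-3)) * exp (-(1/2) * r^2)) (Set.Ioi s) ∧
   ∫ r in Set.Ioi s, r * ((r^2 - 2*a) * (r^2+a-3)) * exp (-(1/2) * r^2) =
     (s^4 + (1-a)*s^2 - 2*a^2+4*a+2) * exp (-(1/2) * s^2) := by
  have hb1 : (0:ℝ) < 1/2 := by norm_num
  have hi : Integrable (fun r : ℝ => r * ((r^2 - 2*a) * (r^2+a-3)) * exp (-(1/2) * r^2)) := by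
    have := (((aux_int 5 hb1).const_mul 1).add ((aux_int 3 hb1).const_mul (-(a+3)))).add
      ((aux_int 1 hb1).const_mul (-2*a^2+6*a))
    refine this.congr (Filter.Eventually.of_forall fun r => ?_)
    simp only [Pi.add_apply]; ring
  refine ⟨hi.integrableOn, ?_⟩
  have hd : ∀ r ∈ Set.Ici s, HasDerivAt (fun r : ℝ => -((r^4 + (1-a)*r^2 - 2*a^2+4*a+2) * exp (-(1/2) * r^2)))
     (r * ((r^2 - 2*a) * (r^2+a-3)) * exp (-(1/2) * r^2)) r := by
    intro u _
    have e1 : HasDerivAt (fun u : ℝ => exp (-(1/2) * u ^ 2)) (exp (-(1/2) * u ^ 2) * (-u)) u := by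
      have := ((hasDerivAt_pow 2 u).const_mul (-(1/2) : ℝ)).exp
      convert this using 1; push_cast; ring
    have := (((((hasDerivAt_pow 4 u).add ((hasDerivAt_pow 2 u).const_mul (1-a))).sub_const (2*a^2)).add_const (4*a)).add_const 2).mul e1 |>.neg
    refine HasDerivAt.congr_deriv this ?_
    simp only [Pi.add_apply]
    push_cast; ring
  have ht : Filter.Tendsto (fun r : ℝ => -((r^4 + (1-a)*r^2 - 2*a^2+4*a+2) * exp (-(1/2) * r^2))) Filter.atTop (nhds 0) := by
    have := (((aux_tend 4 hb1).const_mul (-1)).add ((aux_tend 2 hb1).const_mul (-(1-a)))).add ((aux_tend 0 hb1).const_mul (2*a^2-4*a-2))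
    simp only [mul_zero, add_zero] at this
    refine (this.mono_left atTop_le_cocompact).congr fun r => ?_
    ring
  rw [integral_Ioi_of_hasDerivAt_of_tendsto' hd hi.integrableOn ht]
  ring

lemma aux_radial (u : ℝ) :
   ∫ r in Set.Ioi (0:ℝ), r * (|2*u^2 - r^2| * (r^2+u^2-3)) * exp (-(1/2) * r^2) =
     (12*u^2+4) * exp (-u^2) + 2*u^4 - 4*u^2 - 2 := by
  set s := √2 * |u| with hs
  have hs0 : 0 ≤ s := by positivity
  have hs2 : s^2 = 2*u^2 := by rw [hs, mul_pow, sq_abs, sq_sqrt (by norm_num)]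
  set f : ℝ → ℝ := fun r => r * ((r^2 - 2*u^2) * (r^2+u^2-3)) * exp (-(1/2) * r^2) with hf
  obtain ⟨h0, h0'⟩ := aux_J (u^2) (s := 0)
  obtain ⟨h1, h1'⟩ := aux_J (u^2) (s := s)
  rw [← hf] at h0 h1
  have hA : IntegrableOn (fun r => - f r) (Set.Ioi 0) := h0.neg
  have hB : IntegrableOn (fun r => 2 * (Set.Ioi s).indicator f r) (Set.Ioi 0) :=
    (h0.indicator measurableSet_Ioi).const_mul 2
  have key : ∀ r ∈ Set.Ioi (0:ℝ), r * (|2*u^2 - r^2| * (r^2+u^2-3)) * exp (-(1/2) * r^2) =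
      - f r + 2 * (Set.Ioi s).indicator f r := by
    intro r hr
    by_cases h : s < r
    · have : s^2 ≤ r^2 := by gcongr
      rw [Set.indicator_of_mem (by exact h), abs_of_nonpos (by linarith), hf]; ring
    · have : r^2 ≤ s^2 := by
        have : 0 < r := hr
        gcongr; linarith
      rw [Set.indicator_of_notMem (by exact h), abs_of_nonneg (by linarith), hf]; ring
  rw [setIntegral_congr_fun measurableSet_Ioi key, integral_add hA hB, integral_neg, integral_const_mul,
    setIntegral_indicator measurableSet_Ioi, h0',
    Set.inter_eq_self_of_subset_right (Set.Ioi_subset_Ioi hs0), h1',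
    show s^4 = (s^2)^2 by ring, hs2, show -(1/2) * (2*u^2) = -u^2 by ring]
  simp; ring

lemma aux_pdf (x : ℝ) : gaussianPDFReal 0 1 x = (√(2 * π))⁻¹ * exp (-(1/2) * x ^ 2) := by
  rw [gaussianPDFReal]; simp; left; ring

lemma aux_prod (h : ℝ × ℝ → ℝ) :
    ∫ p, h p ∂((gaussianReal 0 1).prod (gaussianReal 0 1)) =
      ∫ p : ℝ × ℝ, (2 * π)⁻¹ * exp (-(1/2) * (p.1 ^ 2 + p.2 ^ 2)) * h p := by
  have hm : Measurable (gaussianPDF 0 1) := measurable_gaussianPDF 0 1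
  rw [gaussianReal_of_var_ne_zero _ one_ne_zero, prod_withDensity hm hm,
    integral_withDensity_eq_integral_toReal_smul (by fun_prop)
      (ae_of_all _ fun p => ENNReal.mul_lt_top gaussianPDF_lt_top gaussianPDF_lt_top)]
  rw [← Measure.volume_eq_prod]
  congr 1; ext p
  rw [ENNReal.toReal_mul, toReal_gaussianPDF, toReal_gaussianPDF, aux_pdf, aux_pdf, smul_eq_mul]
  congr 1
  rw [show -(1/2) * (p.1 ^ 2 + p.2 ^ 2) = -(1/2) * p.1 ^ 2 + -(1/2) * p.2 ^ 2 by ring, exp_add]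
  have : (√(2 * π))⁻¹ * (√(2 * π))⁻¹ = (2 * π)⁻¹ := by
    rw [← mul_inv, mul_self_sqrt (by positivity)]
  rw [← this]; ring

lemma aux_radint (a : ℝ) (n : ℕ) :
    Integrable (fun r : ℝ => r ^ n * |2 * a - r ^ 2| * exp (-(1/2) * r ^ 2)) := by
  have hb1 : (0:ℝ) < 1/2 := by norm_num
  have := ((aux_int n hb1).const_mul (2*a)).sub (aux_int (n+2) hb1)
  refine this.mono (Continuous.aestronglyMeasurable (by fun_prop)) (ae_of_all _ fun r => le_of_eq ?_)
  simp only [Pi.sub_apply, Real.norm_eq_abs]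
  rw [show 2 * a * (r ^ n * exp (-(1/2) * r ^ 2)) - r ^ (n+2) * exp (-(1/2) * r ^ 2) =
    r ^ n * (2 * a - r ^ 2) * exp (-(1/2) * r ^ 2) by ring]
  simp only [abs_mul, abs_abs]

lemma aux_theta : (∫ _θ in Set.Ioo (-π) π, (1:ℝ)) = 2 * π ∧ (∫ θ in Set.Ioo (-π) π, cos θ) = 0 ∧
    (∫ θ in Set.Ioo (-π) π, cos θ ^ 2) = π := by
  have hp : -π ≤ π := by linarith [pi_pos]
  simp only [← integral_Ioc_eq_integral_Ioo, ← intervalIntegral.integral_of_le hp]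
  refine ⟨by simp; ring, by simp, ?_⟩
  rw [integral_cos_sq]; simp

lemma aux_polar (u : ℝ) :
    ∫ p : ℝ × ℝ, |2 * u ^ 2 - p.1 ^ 2 - p.2 ^ 2| * (((u - √2 * p.1) / √3) ^ 2 - 1)
      ∂((gaussianReal 0 1).prod (gaussianReal 0 1)) =
    (1/3) * ((12*u^2+4) * exp (-u^2) + 2*u^4 - 4*u^2 - 2) := by
  rw [aux_prod, ← integral_comp_polarCoord_symm, ← aux_radial]
  set A : ℕ → ℝ → ℝ := fun n r => r ^ n * |2 * u^2 - r ^ 2| * exp (-(1/2) * r ^ 2) with hA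
  have hAi : ∀ n s, IntegrableOn (A n) s := fun n s => (aux_radint (u^2) n).integrableOn
  have hsplit : ∀ p ∈ polarCoord.target, p.1 • ((2 * π)⁻¹ * exp (-(1/2) *
      ((polarCoord.symm p).1 ^ 2 + (polarCoord.symm p).2 ^ 2)) *
      (|2 * u ^ 2 - (polarCoord.symm p).1 ^ 2 - (polarCoord.symm p).2 ^ 2| *
        (((u - √2 * (polarCoord.symm p).1) / √3) ^ 2 - 1))) =
      (2 * π)⁻¹ * (((u^2/3 - 1) * (A 1 p.1 * 1) + (-2 * √2 * u / 3) * (A 2 p.1 * cos p.2))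
        + (2/3) * (A 3 p.1 * cos p.2 ^ 2)) := by
    rintro ⟨r, θ⟩ _
    have h1 : (r * cos θ) ^ 2 + (r * sin θ) ^ 2 = r ^ 2 := by
      rw [mul_pow, mul_pow, ← mul_add, cos_sq_add_sin_sq, mul_one]
    have h2 : 2 * u ^ 2 - (r * cos θ) ^ 2 - (r * sin θ) ^ 2 = 2 * u ^ 2 - r ^ 2 := by
      rw [← h1]; ring
    have h3 : ((u - √2 * (r * cos θ)) / √3) ^ 2 =
       (u ^ 2 - 2 * √2 * u * r * cos θ + 2 * r ^ 2 * cos θ ^ 2) / 3 := by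
      rw [div_pow, sq_sqrt (by norm_num)]
      congr 1
      have : √2 ^ 2 = 2 := sq_sqrt (by norm_num)
      linear_combination (r * cos θ)^2 * this
    simp only [polarCoord_symm_apply, h1, h2, h3, hA, smul_eq_mul]
    ring
  rw [setIntegral_congr_fun polarCoord.open_target.measurableSet hsplit]
  obtain ⟨t0, t1, t2⟩ := aux_theta
  have hI : ∀ n (g : ℝ → ℝ), Continuous g → IntegrableOn (fun p : ℝ × ℝ => A n p.1 * g p.2)
      polarCoord.target := by
    intro n g hg
    rw [polarCoord_target, IntegrableOn, Measure.volume_eq_prod, ← Measure.prod_restrict]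
    exact (hAi n _).mul_prod
      ((hg.integrableOn_Icc (a := -π) (b := π)).mono_set Set.Ioo_subset_Icc_self)
  have e : ∀ n (g : ℝ → ℝ), ∫ p in polarCoord.target, A n p.1 * g p.2 =
      (∫ r in Set.Ioi 0, A n r) * ∫ θ in Set.Ioo (-π) π, g θ := by
    intro n g
    rw [polarCoord_target, Measure.volume_eq_prod, setIntegral_prod_mul]
  have i0 := (hI 1 (fun _ => 1) continuous_const).const_mul (u^2/3-1)
  have i1 := (hI 2 cos continuous_cos).const_mul (-2 * √2 * u / 3)
  have i2 := (hI 3 (fun θ => cos θ ^ 2) (by fun_prop)).const_mul (2/3)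
  have i01 : IntegrableOn (fun p : ℝ × ℝ => (u^2/3-1) * (A 1 p.1 * 1) +
      (-2 * √2 * u / 3) * (A 2 p.1 * cos p.2)) polarCoord.target := i0.add i1
  rw [integral_const_mul, integral_add i01 i2, integral_add i0 i1, integral_const_mul,
    integral_const_mul, integral_const_mul, e 1 (fun _ => 1), e 2 cos, e 3 (fun θ => cos θ ^ 2),
    t0, t1, t2]
  have : ∀ r : ℝ, r * (|2*u^2 - r^2| * (r^2+u^2-3)) * exp (-(1/2) * r^2) =
     A 3 r + (u^2-3) * A 1 r := by
    intro r; simp only [hA]; ring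
  simp_rw [this]
  rw [integral_add (hAi 3 _) ((hAi 1 _).const_mul _), integral_const_mul]
  field_simp
  ring

lemma aux_rot (G : (Fin 3 → ℝ) → ℝ) (hG : Continuous G) :
    ∫ y, G y ∂gauss3 =
    ∫ w, G ![(√2 * w 0 + w 1) / √3, w 2, (w 0 - √2 * w 1) / √3] ∂gauss3 := by
  have s2 : √2 ^ 2 = 2 := sq_sqrt (by norm_num)
  have s3 : √3 ^ 2 = 3 := sq_sqrt (by norm_num)
  let L0 : EuclideanSpace ℝ (Fin 3) →ₗ[ℝ] EuclideanSpace ℝ (Fin 3) :=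
    { toFun := fun w => !₂[(√2 * w 0 + w 1) / √3, w 2, (w 0 - √2 * w 1) / √3]
      map_add' := by
        intro x y; ext i; fin_cases i <;> simp <;> ring
      map_smul' := by
        intro c x; ext i; fin_cases i <;> simp <;> ring }
  let L1 : EuclideanSpace ℝ (Fin 3) →ₗᵢ[ℝ] EuclideanSpace ℝ (Fin 3) :=
    { L0 with
      norm_map' := by
        intro x
        rw [EuclideanSpace.norm_eq, EuclideanSpace.norm_eq]
        congr 1
        simp only [Fin.sum_univ_three, Real.norm_eq_abs, sq_abs]
        simp [L0]
        rw [div_pow, div_pow, s3]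
        linear_combination (1/3) * ((x 0)^2 + (x 1)^2) * s2 }
  let L := L1.toLinearIsometryEquiv rfl
  have hL := stdGaussian_map L
  rw [← map_pi_eq_stdGaussian] at hL
  change (gauss3.map (WithLp.toLp 2)).map L = gauss3.map (WithLp.toLp 2) at hL
  have c1 : Continuous (fun w : EuclideanSpace ℝ (Fin 3) => G (WithLp.ofLp w)) := by fun_prop
  have m1 : Measurable (WithLp.toLp 2 : (Fin 3 → ℝ) → EuclideanSpace ℝ (Fin 3)) := by fun_prop
  have a1 : ∫ y, G y ∂gauss3 = ∫ w : EuclideanSpace ℝ (Fin 3), G (WithLp.ofLp w) ∂(gauss3.map (WithLp.toLp 2)) := by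
    rw [integral_map m1.aemeasurable c1.aestronglyMeasurable]
  have c2 : Continuous (fun w : EuclideanSpace ℝ (Fin 3) => G (WithLp.ofLp (L w))) :=
    c1.comp L.continuous
  rw [a1, ← hL, integral_map L.continuous.measurable.aemeasurable c1.aestronglyMeasurable,
    integral_map m1.aemeasurable c2.aestronglyMeasurable]
  rfl

lemma aux_fub (G : ℝ → ℝ × ℝ → ℝ) (hG : Continuous (fun q : ℝ × (ℝ × ℝ) => G q.1 q.2)) (C : ℝ)
    (hb : ∀ q : ℝ × (ℝ × ℝ), |G q.1 q.2| ≤ C * (1 + ‖q‖ ^ 4)) :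
    ∫ w, G (w 0) (w 1, w 2) ∂gauss3 = ∫ u, ∫ p, G u p
      ∂((gaussianReal 0 1).prod (gaussianReal 0 1)) ∂(gaussianReal 0 1) := by
  have hi : Integrable (fun q : ℝ × (ℝ × ℝ) => G q.1 q.2)
      ((gaussianReal 0 1).prod ((gaussianReal 0 1).prod (gaussianReal 0 1))) := by
    have hm := (IsGaussian.memLp_id ((gaussianReal 0 1).prod ((gaussianReal 0 1).prod (gaussianReal 0 1))) (4:ℕ) (by simp)).integrable_norm_pow (by simp)
    refine (((integrable_const 1).add hm).const_mul C).mono' hG.aestronglyMeasurable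
      (ae_of_all _ fun q => ?_)
    exact hb q
  rw [← integral_prod (fun q : ℝ × (ℝ × ℝ) => G q.1 q.2) hi]
  have mp1 := measurePreserving_piFinSuccAbove (fun _ : Fin 3 => gaussianReal 0 1) 0
  have mp2 := (MeasurePreserving.id (gaussianReal 0 1)).prod
    (measurePreserving_finTwoArrow (gaussianReal 0 1))
  have mp := mp2.comp mp1
  rw [← mp.map_eq, integral_map mp.measurable.aemeasurable hG.aestronglyMeasurable]
  rfl

/-- With `Y₃ = y 0`, `Y₄ = y 1`, `Y₅ = y 2` independent standard Gaussians,
`E[ |(1/(2√2))·Y₃Y₅ + (1/8)·Y₃² − (1/8)·Y₄²| · H₂(Y₅) ] = 1/(3√3)`, and consequently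
`h₂₅ = −(1/π)·E[...] = −1/(3√3·π)`. -/
theorem expectation_abs_quadratic_mul_H2 :
    (∫ y, |(1 / (2 * Real.sqrt 2)) * (y 0 * y 2) + (1 / 8) * (y 0) ^ 2 - (1 / 8) * (y 1) ^ 2|
        * hermiteEval 2 (y 2) ∂gauss3) = 1 / (3 * Real.sqrt 3) ∧
    -(1 / π) *
      (∫ y, |(1 / (2 * Real.sqrt 2)) * (y 0 * y 2) + (1 / 8) * (y 0) ^ 2 - (1 / 8) * (y 1) ^ 2|
        * hermiteEval 2 (y 2) ∂gauss3) = -(1 / (3 * Real.sqrt 3 * π)) := by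
  have s2 : √2 ^ 2 = 2 := sq_sqrt (by norm_num)
  have s3 : √3 ^ 2 = 3 := sq_sqrt (by norm_num)
  have hH : ∀ x, hermiteEval 2 x = x ^ 2 - 1 := by
    intro x
    simp [hermiteEval, Polynomial.hermite_succ]
    ring
  have main : (∫ y, |(1 / (2 * Real.sqrt 2)) * (y 0 * y 2) + (1 / 8) * (y 0) ^ 2
      - (1 / 8) * (y 1) ^ 2| * hermiteEval 2 (y 2) ∂gauss3) = 1 / (3 * Real.sqrt 3) := by
    simp_rw [hH]
    rw [aux_rot _ (by fun_prop)]
    have hq : ∀ w : Fin 3 → ℝ, |(1 / (2 * √2)) * (![(√2 * w 0 + w 1) / √3, w 2, (w 0 - √2 * w 1) / √3] 0 * ![(√2 * w 0 + w 1) / √3, w 2, (w 0 - √2 * w 1) / √3] 2) + (1 / 8) * (![(√2 * w 0 + w 1) / √3, w 2, (w 0 - √2 * w 1) / √3] 0) ^ 2 - (1 / 8) * (![(√2 * w 0 + w 1) / √3, w 2, (w 0 - √2 * w 1) / √3] 1) ^ 2|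
        * (![(√2 * w 0 + w 1) / √3, w 2, (w 0 - √2 * w 1) / √3] 2 ^ 2 - 1) =
        (1/8) * (|2 * (w 0) ^ 2 - (w 1, w 2).1 ^ 2 - (w 1, w 2).2 ^ 2| *
          (((w 0 - √2 * (w 1, w 2).1) / √3) ^ 2 - 1)) := by
      intro w
      simp only [Matrix.cons_val]
      have : (1 / (2 * √2)) * ((√2 * w 0 + w 1) / √3 * ((w 0 - √2 * w 1) / √3)) +
          (1 / 8) * ((√2 * w 0 + w 1) / √3) ^ 2 - (1 / 8) * (w 2) ^ 2 =
          (1/8) * (2 * (w 0) ^ 2 - (w 1) ^ 2 - (w 2) ^ 2) := by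
        have h2 : 1 / (2 * √2) = √2 / 4 := by
          field_simp; rw [s2]; norm_num
        rw [h2, div_mul_div_comm, ← sq, div_pow, s3]
        linear_combination (1/12 * (w 0)^2 - 1/12 * (w 1)^2 + 1/24 * (w 0)^2 - 1/12 * w 0 * w 1 * √2) * s2
      rw [this, abs_mul, abs_of_pos (by norm_num : (0:ℝ) < 1/8)]
      ring
    simp_rw [hq]
    rw [integral_const_mul, aux_fub (fun u p => |2 * u ^ 2 - p.1 ^ 2 - p.2 ^ 2| *
      (((u - √2 * p.1) / √3) ^ 2 - 1)) (by fun_prop) 100]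
    · simp_rw [aux_polar]
      rw [integral_const_mul, aux_final]
      field_simp
    · rintro ⟨u, v, y⟩
      set N := ‖((u, v, y) : ℝ × ℝ × ℝ)‖ with hN
      have hu : |u| ≤ N := norm_fst_le ((u, v, y) : ℝ × ℝ × ℝ)
      have hvy : ‖(v, y)‖ ≤ N := norm_snd_le ((u, v, y) : ℝ × ℝ × ℝ)
      have hv : |v| ≤ N := (norm_fst_le (v, y)).trans hvy
      have hy : |y| ≤ N := (norm_snd_le (v, y)).trans hvy
      have hu2 : u ^ 2 ≤ N ^ 2 := sq_le_sq.2 (hu.trans (le_abs_self _))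
      have hv2 : v ^ 2 ≤ N ^ 2 := sq_le_sq.2 (hv.trans (le_abs_self _))
      have hy2 : y ^ 2 ≤ N ^ 2 := sq_le_sq.2 (hy.trans (le_abs_self _))
      have b1 : |2 * u ^ 2 - v ^ 2 - y ^ 2| ≤ 4 * N ^ 2 := by
        rw [abs_le]; constructor <;> nlinarith [sq_nonneg u, sq_nonneg v, sq_nonneg y]
      have b2 : |((u - √2 * v) / √3) ^ 2 - 1| ≤ 2 * N ^ 2 + 1 := by
        have h0 : 0 ≤ ((u - √2 * v) / √3) ^ 2 := sq_nonneg _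
        have h1 : ((u - √2 * v) / √3) ^ 2 ≤ 2 * N ^ 2 := by
          rw [div_pow, s3, div_le_iff₀ (by norm_num)]
          have : (√2 * v) ^ 2 = 2 * v ^ 2 := by rw [mul_pow, s2]
          nlinarith [sq_nonneg (u + √2 * v)]
        rw [abs_le]; constructor <;> nlinarith [sq_nonneg N]
      simp only
      rw [abs_mul, abs_abs]
      calc _ ≤ 4 * N ^ 2 * (2 * N ^ 2 + 1) := by gcongr
        _ ≤ _ := by nlinarith [sq_nonneg (N ^ 2 - 1), sq_nonneg (N^2)]
  refine ⟨main, ?_⟩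
  rw [main]
  field_simp
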